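/- arXiv:2107.05328 — 5 statements merged into one kernel-verified Lean document; each statement's English description precedes it below -/
import Mathlib

section
/- Let d ≥ 1, let w* ∈ ℝ^d be nonzero, let λ > 0 and s ∈ ℝ. Then the vector ŵ := (1 − λs/‖w*‖₂)₊ · w* is a global minimizer of f over ℝ^d, i.e. f(ŵ) ≤ f(w) for all w ∈ ℝ^d. -/
/-- The quadratic `t ↦ (n - t)² / 2 + a t` is minimized over `t ≥ 0` at `max (n - a) 0`. -/
lemma half_sq_sub_add_mul_max_le (n a t : ℝ) (ht : 0 ≤ t) :
    (1 / 2) * (n - max (n - a) 0) ^ 2 + a * max (n - a) 0 ≤ (1 / 2) * (n - t) ^ 2 + a * t := by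
  rcases le_total (n - a) 0 with h | h
  · rw [max_eq_right h]
    nlinarith [mul_nonneg ht (neg_nonneg.mpr h), sq_nonneg t]
  · rw [max_eq_left h]
    nlinarith [sq_nonneg (t - (n - a))]

/-- `ŵ := (1 − λs/‖w*‖₂)₊ · w*` is a global minimizer of
`f(w) = (1/2)·‖w* − w‖₂² + λ·s·‖w‖₂` over `ℝ^d`. -/
theorem stmt_0 (d : ℕ) (hd : 1 ≤ d) (wstar : EuclideanSpace ℝ (Fin d)) (hwstar : wstar ≠ 0)
    (lam s : ℝ) (hlam : 0 < lam) :
    ∀ w : EuclideanSpace ℝ (Fin d),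
      (1 / 2) * ‖wstar - (max (1 - lam * s / ‖wstar‖) 0) • wstar‖ ^ 2
          + lam * s * ‖(max (1 - lam * s / ‖wstar‖) 0) • wstar‖
        ≤ (1 / 2) * ‖wstar - w‖ ^ 2 + lam * s * ‖w‖ := by
  intro w
  have hn : 0 < ‖wstar‖ := norm_pos_iff.mpr hwstar
  set c := max (1 - lam * s / ‖wstar‖) 0 with hc
  have hc0 : 0 ≤ c := le_max_right _ _
  have hcn : c * ‖wstar‖ = max (‖wstar‖ - lam * s) 0 := by
    rw [hc, max_mul_of_nonneg _ _ hn.le, zero_mul, sub_mul, one_mul, div_mul_cancel₀ _ hn.ne']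
  have hsmul : ‖c • wstar‖ = max (‖wstar‖ - lam * s) 0 := by
    rw [norm_smul, Real.norm_of_nonneg hc0, hcn]
  have hsub : ‖wstar - c • wstar‖ ^ 2 = (‖wstar‖ - max (‖wstar‖ - lam * s) 0) ^ 2 := by
    rw [← hcn, show wstar - c • wstar = (1 - c) • wstar by rw [sub_smul, one_smul],
      norm_smul, mul_pow, Real.norm_eq_abs, sq_abs]
    ring
  have htri : (‖wstar‖ - ‖w‖) ^ 2 ≤ ‖wstar - w‖ ^ 2 :=
    sq_le_sq.mpr ((abs_norm_sub_norm_le wstar w).trans (le_abs_self _))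
  rw [hsmul, hsub]
  linarith [half_sq_sub_add_mul_max_le ‖wstar‖ (lam * s) ‖w‖ (norm_nonneg w)]
end

section
/- Let d ≥ 1, let w* ∈ ℝ^d be nonzero, let λ > 0 and s ≥ 0. Then ŵ := (1 − λs/‖w*‖₂)₊ · w* is the unique global minimizer of f: for every w ∈ ℝ^d with w ≠ ŵ one has f(ŵ) < f(w). -/
/-- Quadratic growth of the objective `w ↦ ‖v - w‖² / 2 + c ‖w‖` around a point `t • v` that
satisfies the first-order optimality conditions. -/
theorem half_sq_norm_sub_add_mul_norm_growth {E : Type*} [NormedAddCommGroup E]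
    [InnerProductSpace ℝ E] (v w : E) {c t : ℝ} (ht0 : 0 ≤ t) (ht1 : t ≤ 1)
    (hle : (1 - t) * ‖v‖ ≤ c) (hcompl : t * ((1 - t) * ‖v‖ - c) = 0) :
    (1 / 2) * ‖v - t • v‖ ^ 2 + c * ‖t • v‖ + (1 / 2) * ‖w - t • v‖ ^ 2
      ≤ (1 / 2) * ‖v - w‖ ^ 2 + c * ‖w‖ := by
  have hv : ‖v - t • v‖ = (1 - t) * ‖v‖ := by
    rw [← norm_smul_of_nonneg (sub_nonneg.2 ht1), sub_smul, one_smul]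
  have hw : ‖w - t • v‖ ^ 2 = ‖w‖ ^ 2 - 2 * (t * inner ℝ v w) + (t * ‖v‖) ^ 2 := by
    rw [norm_sub_sq_real, real_inner_smul_right, real_inner_comm, norm_smul_of_nonneg ht0]
  rw [hv, hw, norm_smul_of_nonneg ht0, norm_sub_sq_real]
  have hinner := mul_le_mul_of_nonneg_left (real_inner_le_norm v w) (sub_nonneg.2 ht1)
  have hnorm := mul_le_mul_of_nonneg_right hle (norm_nonneg w)
  linear_combination hinner + hnorm - ‖v‖ * hcompl


/-- for `s ≥ 0`, `ŵ := (1 − λs/‖w*‖₂)₊ · w*` is the unique global minimizer of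
`f(w) = (1/2)·‖w* − w‖₂² + λ·s·‖w‖₂`. -/
theorem stmt_1 (d : ℕ) (hd : 1 ≤ d) (wstar : EuclideanSpace ℝ (Fin d)) (hwstar : wstar ≠ 0)
    (lam s : ℝ) (hlam : 0 < lam) (hs : 0 ≤ s) :
    ∀ w : EuclideanSpace ℝ (Fin d), w ≠ (max (1 - lam * s / ‖wstar‖) 0) • wstar →
      (1 / 2) * ‖wstar - (max (1 - lam * s / ‖wstar‖) 0) • wstar‖ ^ 2
          + lam * s * ‖(max (1 - lam * s / ‖wstar‖) 0) • wstar‖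
        < (1 / 2) * ‖wstar - w‖ ^ 2 + lam * s * ‖w‖ := by
  intro w hw
  have ha : 0 < ‖wstar‖ := norm_pos_iff.2 hwstar
  have hc : 0 ≤ lam * s := mul_nonneg hlam.le hs
  have hmul : (1 - lam * s / ‖wstar‖) * ‖wstar‖ = ‖wstar‖ - lam * s := by field_simp
  set t := max (1 - lam * s / ‖wstar‖) 0 with ht
  have ht1 : t ≤ 1 := max_le (sub_le_self _ (by positivity)) zero_le_one
  have hle : (1 - t) * ‖wstar‖ ≤ lam * s := by
    have := mul_le_mul_of_nonneg_right (le_max_left (1 - lam * s / ‖wstar‖) 0) ha.le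
    linarith
  have hcompl : t * ((1 - t) * ‖wstar‖ - lam * s) = 0 := by
    rcases max_choice (1 - lam * s / ‖wstar‖) 0 with h | h
    · rw [ht, h]
      linear_combination (-(1 - lam * s / ‖wstar‖)) * hmul
    · rw [ht, h, zero_mul]
  have hgrowth :=
    half_sq_norm_sub_add_mul_norm_growth wstar w (le_max_right _ _) ht1 hle hcompl
  have hpos : 0 < ‖w - t • wstar‖ ^ 2 := pow_pos (norm_pos_iff.2 (sub_ne_zero.2 hw)) 2
  linarith
end

section
/- Let d ≥ 1, let w* ∈ ℝ^d be nonzero, let λ > 0 and s < 0. Then ŵ := (1 − λs/‖w*‖₂) · w* is the unique global minimizer of f: for every w ∈ ℝ^d with w ≠ ŵ one has f(ŵ) < f(w). (Note that 1 − λs/‖w*‖₂ > 1, so the positive part is not needed in this case.) -/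
/-- for `s < 0`, `ŵ := (1 − λs/‖w*‖₂) · w*` is the unique global minimizer of
`f(w) = (1/2)·‖w* − w‖₂² + λ·s·‖w‖₂`. -/
theorem stmt_2 (d : ℕ) (hd : 1 ≤ d) (wstar : EuclideanSpace ℝ (Fin d)) (hwstar : wstar ≠ 0)
    (lam s : ℝ) (hlam : 0 < lam) (hs : s < 0) :
    ∀ w : EuclideanSpace ℝ (Fin d), w ≠ (1 - lam * s / ‖wstar‖) • wstar →
      (1 / 2) * ‖wstar - (1 - lam * s / ‖wstar‖) • wstar‖ ^ 2
          + lam * s * ‖(1 - lam * s / ‖wstar‖) • wstar‖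
        < (1 / 2) * ‖wstar - w‖ ^ 2 + lam * s * ‖w‖ := by
  intro w hw
  have hn : 0 < ‖wstar‖ := norm_pos_iff.mpr hwstar
  have hc : lam * s < 0 := mul_neg_of_pos_of_neg hlam hs
  have hCS : inner ℝ wstar w ≤ ‖wstar‖ * ‖w‖ := real_inner_le_norm wstar w
  have hk : 0 < 1 - lam * s / ‖wstar‖ := by
    have := div_neg_of_neg_of_pos hc hn
    linarith
  have hkn : (1 - lam * s / ‖wstar‖) * ‖wstar‖ = ‖wstar‖ - lam * s := by
    field_simp
  have hpos : 0 < ‖w - (1 - lam * s / ‖wstar‖) • wstar‖ ^ 2 :=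
    pow_pos (norm_pos_iff.mpr (sub_ne_zero.mpr hw)) 2
  generalize 1 - lam * s / ‖wstar‖ = k at *
  have hnorm : ‖k • wstar‖ = ‖wstar‖ - lam * s := by
    rw [norm_smul, Real.norm_of_nonneg hk.le, hkn]
  rw [norm_sub_sq_real, real_inner_smul_right, real_inner_comm, hnorm] at hpos
  rw [norm_sub_sq_real, norm_sub_sq_real, real_inner_smul_right, real_inner_self_eq_norm_sq,
    hnorm]
  have hkn2 : k * ‖wstar‖ ^ 2 = (‖wstar‖ - lam * s) * ‖wstar‖ := by rw [← hkn]; ring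
  have hsum : 0 < (‖w‖ - (‖wstar‖ - lam * s)) ^ 2
      + 2 * k * (‖wstar‖ * ‖w‖ - inner ℝ wstar w) := by
    linear_combination hpos - 2 * ‖w‖ * hkn
  have hgap : 0 < (1 / 2) * (‖w‖ - (‖wstar‖ - lam * s)) ^ 2
      + (‖wstar‖ * ‖w‖ - inner ℝ wstar w) := by
    rcases hCS.lt_or_eq with h | h
    · have := sq_nonneg (‖w‖ - (‖wstar‖ - lam * s))
      linarith
    · rw [h, sub_self, mul_zero] at hsum
      rw [h]
      linarith
  linear_combination hgap - hkn2
end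

section
/- Let d ≥ 1, w* ∈ ℝ^d, λ > 0 and s < 0. For every w ∈ ℝ^d with ‖w‖₂ = −λs, the function f is differentiable at w and its gradient there equals −w*, i.e. HasGradientAt f (−w*) w. In particular, if w* ≠ 0, then f has no stationary point on the sphere of radius −λs. -/
theorem hasGradientAt_norm {E : Type*} [NormedAddCommGroup E] [InnerProductSpace ℝ E]
    [CompleteSpace E] {x : E} (hx : x ≠ 0) :
    HasGradientAt (fun u : E => ‖u‖) (‖x‖⁻¹ • x) x := by
  rw [hasGradientAt_iff_hasFDerivAt]
  have hn : ‖x‖ ≠ 0 := norm_ne_zero_iff.mpr hx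
  have h := (hasFDerivAt_id x).norm_sq.sqrt (pow_ne_zero 2 hn)
  simp only [id, Real.sqrt_sq (norm_nonneg _)] at h
  refine h.congr_fderiv ?_
  ext y
  simp
  field_simp

theorem hasGradientAt_half_norm_sub_sq {E : Type*} [NormedAddCommGroup E] [InnerProductSpace ℝ E]
    [CompleteSpace E] (a x : E) :
    HasGradientAt (fun u : E => (1 / 2) * ‖a - u‖ ^ 2) (x - a) x := by
  rw [hasGradientAt_iff_hasFDerivAt]
  refine (((hasFDerivAt_id x).const_sub a).norm_sq.const_mul (1 / 2 : ℝ)).congr_fderiv ?_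
  ext y
  simp


/-- for `s < 0`, at every `w` with `‖w‖₂ = −λs` the gradient of
`f(w) = (1/2)·‖w* − w‖₂² + λ·s·‖w‖₂` equals `−w*`; in particular if `w* ≠ 0` then
`f` has no stationary point on this sphere. -/
theorem stmt_7 (d : ℕ) (hd : 1 ≤ d) (wstar : EuclideanSpace ℝ (Fin d))
    (lam s : ℝ) (hlam : 0 < lam) (hs : s < 0) :
    ∀ w : EuclideanSpace ℝ (Fin d), ‖w‖ = -(lam * s) →
      HasGradientAt
        (fun u : EuclideanSpace ℝ (Fin d) => (1 / 2) * ‖wstar - u‖ ^ 2 + lam * s * ‖u‖)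
        (-wstar) w
      ∧ (wstar ≠ 0 →
        ¬ HasGradientAt
          (fun u : EuclideanSpace ℝ (Fin d) => (1 / 2) * ‖wstar - u‖ ^ 2 + lam * s * ‖u‖)
          0 w) := by
  intro w hw
  have hc : lam * s < 0 := mul_neg_of_pos_of_neg hlam hs
  have hw0 : w ≠ 0 := norm_pos_iff.mp (by linarith)
  have hgrad : HasGradientAt
      (fun u : EuclideanSpace ℝ (Fin d) => (1 / 2) * ‖wstar - u‖ ^ 2 + lam * s * ‖u‖)
      (-wstar) w := by
    have hcw : lam * s * ‖w‖⁻¹ = -1 := by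
      rw [hw, inv_neg, mul_neg, mul_inv_cancel₀ hc.ne]
    rw [hasGradientAt_iff_hasFDerivAt]
    refine ((hasGradientAt_half_norm_sub_sq wstar w).hasFDerivAt.add
      ((hasGradientAt_norm hw0).hasFDerivAt.const_mul (lam * s))).congr_fderiv ?_
    ext y
    simp [← mul_assoc, hcw]
    ring
  exact ⟨hgrad, fun hne h0 => hne (neg_eq_zero.mp (hgrad.unique h0))⟩
end

section
/- Let d ≥ 1, let w* ∈ ℝ^d be nonzero, let λ > 0 and s ∈ ℝ. If λs ≤ ‖w*‖₂, then the infimum of f over ℝ^d equals λs·‖w*‖₂ − (λs)²/2; if λs ≥ ‖w*‖₂, then the infimum of f over ℝ^d equals (1/2)·‖w*‖₂². -/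
/-- Replacing `‖x - w‖` by `|‖x‖ - ‖w‖|` bounds the norm-regularized quadratic from below. -/
theorem half_sq_norm_sub_norm_le {E : Type*} [SeminormedAddCommGroup E] (x w : E) :
    (1 / 2) * (‖x‖ - ‖w‖) ^ 2 ≤ (1 / 2) * ‖x - w‖ ^ 2 := by
  have h := sq_le_sq' (neg_le_of_abs_le (abs_norm_sub_norm_le x w))
    (le_of_abs_le (abs_norm_sub_norm_le x w))
  linarith

/-- Below the threshold `a ≤ ‖x‖`, the minimizer is the shrunken vector `((‖x‖ - a) / ‖x‖) • x`. -/
theorem isLeast_range_norm_prox_of_le {E : Type*} [NormedAddCommGroup E] [NormedSpace ℝ E]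
    {x : E} (hx : x ≠ 0) {a : ℝ} (ha : a ≤ ‖x‖) :
    IsLeast (Set.range fun w : E => (1 / 2) * ‖x - w‖ ^ 2 + a * ‖w‖)
      (a * ‖x‖ - a ^ 2 / 2) := by
  have hn : 0 < ‖x‖ := norm_pos_iff.mpr hx
  refine ⟨⟨((‖x‖ - a) / ‖x‖) • x, ?_⟩, ?_⟩
  · have h₁ : x - ((‖x‖ - a) / ‖x‖) • x = (a / ‖x‖) • x := by
      rw [sub_div, div_self hn.ne', sub_smul, one_smul, sub_sub_cancel]
    have h₂ : ‖((‖x‖ - a) / ‖x‖) • x‖ = ‖x‖ - a := by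
      rw [norm_smul, Real.norm_of_nonneg (div_nonneg (sub_nonneg.mpr ha) hn.le),
        div_mul_cancel₀ _ hn.ne']
    have h₃ : ‖(a / ‖x‖) • x‖ ^ 2 = a ^ 2 := by
      rw [norm_smul, mul_pow, Real.norm_eq_abs, sq_abs, ← mul_pow, div_mul_cancel₀ _ hn.ne']
    simp only [h₁, h₂, h₃]
    ring
  · rintro _ ⟨w, rfl⟩
    have h := half_sq_norm_sub_norm_le x w
    dsimp only
    nlinarith [sq_nonneg (‖x‖ - ‖w‖ - a)]

/-- Above the threshold `‖x‖ ≤ a`, the minimizer is `0`. -/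
theorem isLeast_range_norm_prox_of_ge {E : Type*} [SeminormedAddCommGroup E]
    {x : E} {a : ℝ} (ha : ‖x‖ ≤ a) :
    IsLeast (Set.range fun w : E => (1 / 2) * ‖x - w‖ ^ 2 + a * ‖w‖) ((1 / 2) * ‖x‖ ^ 2) := by
  refine ⟨⟨0, by simp⟩, ?_⟩
  rintro _ ⟨w, rfl⟩
  have h := half_sq_norm_sub_norm_le x w
  dsimp only
  nlinarith [mul_nonneg (sub_nonneg.mpr ha) (norm_nonneg w), sq_nonneg ‖w‖]

/-- the infimum of `f(w) = (1/2)·‖w* − w‖₂² + λ·s·‖w‖₂` equals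
`λs·‖w*‖₂ − (λs)²/2` when `λs ≤ ‖w*‖₂`, and equals `(1/2)·‖w*‖₂²` when `λs ≥ ‖w*‖₂`. -/
theorem stmt_11 (d : ℕ) (hd : 1 ≤ d) (wstar : EuclideanSpace ℝ (Fin d)) (hwstar : wstar ≠ 0)
    (lam s : ℝ) (hlam : 0 < lam) :
    (lam * s ≤ ‖wstar‖ →
      (⨅ w : EuclideanSpace ℝ (Fin d), ((1 / 2) * ‖wstar - w‖ ^ 2 + lam * s * ‖w‖))
        = lam * s * ‖wstar‖ - (lam * s) ^ 2 / 2)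
    ∧ (‖wstar‖ ≤ lam * s →
      (⨅ w : EuclideanSpace ℝ (Fin d), ((1 / 2) * ‖wstar - w‖ ^ 2 + lam * s * ‖w‖))
        = (1 / 2) * ‖wstar‖ ^ 2) := by
  exact ⟨fun h => (isLeast_range_norm_prox_of_le hwstar h).csInf_eq,
    fun h => (isLeast_range_norm_prox_of_ge h).csInf_eq⟩
end
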